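/- For every index i with 1 ≤ i ≤ L−1 and every (t,α) ∈ ℝ × ℝ^{L−1}, the contraction ⟨R(X_0,X_i)X_0, X_i⟩ = Σ_{s=0}^{L−1} R^s_{0i0}(t,α) g_{si}(t,α) equals −(p_i'(t))² B(t) / (N(t) B(t) + A(t,α)²). -/

import Mathlib

/-!
Formalization of results from "A geometric approach to equilibrium selection":
the metric, Christoffel symbols and curvature of the equilibrium manifold of a
two-consumer exchange economy with `L` goods, parametrized by
`Φ(t,α) = (p_1(t),…,p_{L−1}(t), α_1,…,α_{L−1}, w(t) − Σ_m p_m(t) α_m)`.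

Indices run over `Fin L`, where the index `0` corresponds to the coordinate
`x_0 = t` and an index `i ≠ 0` corresponds to the coordinate `x_i = α_i`
(the component `α 0` of `α : Fin L → ℝ` is never used, so `α` is just a copy
of `ℝ^{L−1}` together with an irrelevant extra coordinate).
-/

open Matrix BigOperators

noncomputable section

namespace EqSelection

variable {L : ℕ}

/-- `A(t,α) = w'(t) − Σ_{m=1}^{L−1} p_m'(t) α_m`. -/
def eqA [NeZero L] (p : Fin L → ℝ → ℝ) (w : ℝ → ℝ) (t : ℝ) (α : Fin L → ℝ) : ℝ :=
  deriv w t - ∑ m ∈ Finset.univ \ {0}, deriv (p m) t * α m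

/-- `A'(t,α) = w''(t) − Σ_{m=1}^{L−1} p_m''(t) α_m`. -/
def eqA' [NeZero L] (p : Fin L → ℝ → ℝ) (w : ℝ → ℝ) (t : ℝ) (α : Fin L → ℝ) : ℝ :=
  deriv (deriv w) t - ∑ m ∈ Finset.univ \ {0}, deriv (deriv (p m)) t * α m

/-- `B(t) = Σ_{m=1}^{L−1} (p_m'(t))²`. -/
def eqB [NeZero L] (p : Fin L → ℝ → ℝ) (t : ℝ) : ℝ :=
  ∑ m ∈ Finset.univ \ {0}, (deriv (p m) t) ^ 2

/-- `N(t) = 1 + Σ_{m=1}^{L−1} (p_m(t))²`. -/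
def eqN [NeZero L] (p : Fin L → ℝ → ℝ) (t : ℝ) : ℝ :=
  1 + ∑ m ∈ Finset.univ \ {0}, (p m t) ^ 2

/-- `C(t) = Σ_{m=1}^{L−1} p_m'(t) p_m''(t)`. -/
def eqC [NeZero L] (p : Fin L → ℝ → ℝ) (t : ℝ) : ℝ :=
  ∑ m ∈ Finset.univ \ {0}, deriv (p m) t * deriv (deriv (p m)) t

/-- `P(t) = Σ_{m=1}^{L−1} p_m(t) p_m'(t)`. -/
def eqP [NeZero L] (p : Fin L → ℝ → ℝ) (t : ℝ) : ℝ :=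
  ∑ m ∈ Finset.univ \ {0}, p m t * deriv (p m) t

/-- The induced metric matrix `g(t,α)`: `g_{00} = B + A²`, `g_{0i} = g_{i0} = −p_i A`,
`g_{ij} = p_i p_j + δ_{ij}` for `i, j ≠ 0`. -/
def gMat [NeZero L] (p : Fin L → ℝ → ℝ) (w : ℝ → ℝ) (t : ℝ) (α : Fin L → ℝ) :
    Matrix (Fin L) (Fin L) ℝ :=
  Matrix.of fun i j =>
    if i = 0 then
      if j = 0 then eqB p t + (eqA p w t α) ^ 2 else -(p j t) * eqA p w t α
    else
      if j = 0 then -(p i t) * eqA p w t α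
      else p i t * p j t + (if i = j then 1 else 0)

/-- Partial derivative with respect to the coordinate `x_k`, where `x_0 = t`
and `x_i = α_i` for `i ≠ 0`. -/
def pder [NeZero L] (k : Fin L) (f : ℝ → (Fin L → ℝ) → ℝ) (t : ℝ) (α : Fin L → ℝ) : ℝ :=
  if k = 0 then deriv (fun s => f s α) t
  else deriv (fun s => f t (Function.update α k s)) (α k)

/-- Christoffel symbol
`Γ^k_{ij} = (1/2) Σ_{h=0}^{L−1} g^{hk} (∂g_{jh}/∂x_i + ∂g_{hi}/∂x_j − ∂g_{ij}/∂x_h)`,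
written `christoffel p w i j k`.  (Here `g^{hk}` denotes the entries of the inverse
matrix of `g`, i.e. of `(gMat p w t α)⁻¹`.) -/
def christoffel [NeZero L] (p : Fin L → ℝ → ℝ) (w : ℝ → ℝ) (i j k : Fin L)
    (t : ℝ) (α : Fin L → ℝ) : ℝ :=
  (1 / 2) * ∑ h : Fin L,
    (gMat p w t α)⁻¹ h k *
      (pder i (fun t' α' => gMat p w t' α' j h) t α
        + pder j (fun t' α' => gMat p w t' α' h i) t α
        - pder h (fun t' α' => gMat p w t' α' i j) t α)

/-- Curvature coefficient
`R^s_{ijk} = Σ_{m} Γ^m_{ik} Γ^s_{jm} − Σ_{m} Γ^m_{jk} Γ^s_{im} + ∂Γ^s_{ik}/∂x_j − ∂Γ^s_{jk}/∂x_i`,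
written `curvR p w i j k s`. -/
def curvR [NeZero L] (p : Fin L → ℝ → ℝ) (w : ℝ → ℝ) (i j k s : Fin L)
    (t : ℝ) (α : Fin L → ℝ) : ℝ :=
  (∑ m : Fin L, christoffel p w i k m t α * christoffel p w j m s t α)
    - (∑ m : Fin L, christoffel p w j k m t α * christoffel p w i m s t α)
    + pder j (christoffel p w i k s) t α - pder i (christoffel p w j k s) t α

/-- The coordinate tangent vectors `Φ_i(t,α) ∈ ℝ^{2L−1}` of the parametrization
`Φ(t,α) = (p_1(t),…,p_{L−1}(t), α_1,…,α_{L−1}, w(t) − Σ_m p_m(t) α_m)`: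
`Φ_0 = (p_1',…,p_{L−1}', 0,…,0, A)`, and for `i ≠ 0` the vector `Φ_i` has entry `1`
in position `(L−1)+i` (1-indexed), entry `−p_i` in the last position and `0` elsewhere. -/
def PhiVec [NeZero L] (p : Fin L → ℝ → ℝ) (w : ℝ → ℝ) (i : Fin L)
    (t : ℝ) (α : Fin L → ℝ) : Fin (2 * L - 1) → ℝ :=
  fun j =>
    if i = 0 then
      if h : (j : ℕ) < L - 1 then deriv (p ⟨(j : ℕ) + 1, by omega⟩) t
      else if (j : ℕ) = 2 * L - 2 then eqA p w t α else 0
    else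
      if (j : ℕ) + 1 = (L - 1) + (i : ℕ) then 1
      else if (j : ℕ) = 2 * L - 2 then -(p i t) else 0

/-- The matrix `M(t,α)` of Statement 2: `M_{00} = N`, `M_{0i} = M_{i0} = p_i A`,
`M_{ii} = (N − p_i²) B + A²`, `M_{ij} = −p_i p_j B` for `i ≠ j`, `i, j ≠ 0`. -/
def invNumer [NeZero L] (p : Fin L → ℝ → ℝ) (w : ℝ → ℝ) (t : ℝ) (α : Fin L → ℝ) :
    Matrix (Fin L) (Fin L) ℝ :=
  Matrix.of fun i j =>
    if i = 0 then
      if j = 0 then eqN p t else p j t * eqA p w t α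
    else
      if j = 0 then p i t * eqA p w t α
      else if i = j then (eqN p t - (p i t) ^ 2) * eqB p t + (eqA p w t α) ^ 2
      else -(p i t * p j t * eqB p t)

/-- Christoffel symbols of the first kind. -/
def lowerChristoffel [NeZero L] (p : Fin L → ℝ → ℝ) (w : ℝ → ℝ) (i j h : Fin L)
    (t : ℝ) (α : Fin L → ℝ) : ℝ :=
  (1 / 2) * (pder i (fun t' α' => gMat p w t' α' j h) t α
        + pder j (fun t' α' => gMat p w t' α' h i) t α
        - pder h (fun t' α' => gMat p w t' α' i j) t α)

theorem sum_univ_eq_zero_add [NeZero L] (f : Fin L → ℝ) :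
    ∑ m, f m = f 0 + ∑ m ∈ Finset.univ \ {0}, f m := by
  rw [← Finset.sum_sdiff (Finset.subset_univ ({0} : Finset (Fin L))), Finset.sum_singleton,
    add_comm]

/-! ### Derivatives of the coefficient functions -/

theorem hasDerivAt_eqA_time [NeZero L] {p : Fin L → ℝ → ℝ} {w : ℝ → ℝ}
    (hp : ∀ i, Differentiable ℝ (deriv (p i))) (hw : Differentiable ℝ (deriv w))
    (t : ℝ) (α : Fin L → ℝ) :
    HasDerivAt (fun s => eqA p w s α) (eqA' p w t α) t :=
  (hw t).hasDerivAt.sub (HasDerivAt.fun_sum fun m _ => (hp m t).hasDerivAt.mul_const _)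

theorem hasDerivAt_sum_mul_update [NeZero L] (c α : Fin L → ℝ) {k : Fin L} (hk : k ≠ 0) (x : ℝ) :
    HasDerivAt (fun s => ∑ m ∈ Finset.univ \ {0}, c m * Function.update α k s m) (c k) x := by
  have h : ∀ m ∈ Finset.univ \ {(0 : Fin L)},
      HasDerivAt (fun s => c m * Function.update α k s m) (if m = k then c k else 0) x := by
    intro m _
    by_cases hm : m = k
    · subst hm
      simpa using (hasDerivAt_id x).const_mul (c m)
    · simpa [hm] using hasDerivAt_const x (c m * α m)
  have h' := HasDerivAt.fun_sum h
  rwa [Finset.sum_ite_eq' _ k, if_pos (by simp [hk])] at h'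

theorem hasDerivAt_eqA_coord [NeZero L] (p : Fin L → ℝ → ℝ) (w : ℝ → ℝ) (t : ℝ)
    (α : Fin L → ℝ) {k : Fin L} (hk : k ≠ 0) (x : ℝ) :
    HasDerivAt (fun s => eqA p w t (Function.update α k s)) (-deriv (p k) t) x := by
  simpa [eqA] using
    (hasDerivAt_sum_mul_update (fun m => deriv (p m) t) α hk x).const_sub (deriv w t)

theorem hasDerivAt_eqA'_coord [NeZero L] (p : Fin L → ℝ → ℝ) (w : ℝ → ℝ) (t : ℝ)
    (α : Fin L → ℝ) {k : Fin L} (hk : k ≠ 0) (x : ℝ) :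
    HasDerivAt (fun s => eqA' p w t (Function.update α k s)) (-deriv (deriv (p k)) t) x := by
  simpa [eqA'] using
    (hasDerivAt_sum_mul_update (fun m => deriv (deriv (p m)) t) α hk x).const_sub
      (deriv (deriv w) t)

theorem hasDerivAt_eqB [NeZero L] {p : Fin L → ℝ → ℝ}
    (hp : ∀ i, Differentiable ℝ (deriv (p i))) (t : ℝ) :
    HasDerivAt (eqB p) (2 * eqC p t) t := by
  have h := HasDerivAt.fun_sum (u := Finset.univ \ {(0 : Fin L)})
    fun m _ => (hp m t).hasDerivAt.pow 2
  refine h.congr_deriv ?_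
  rw [eqC, Finset.mul_sum]
  refine Finset.sum_congr rfl fun m _ => ?_
  simp
  ring

theorem differentiable_eqN [NeZero L] {p : Fin L → ℝ → ℝ} (hp : ∀ i, Differentiable ℝ (p i)) :
    Differentiable ℝ (eqN p) := by
  unfold eqN
  fun_prop

/-! ### Entries of the metric and their partial derivatives -/

section Entries

variable [NeZero L] (p : Fin L → ℝ → ℝ) (w : ℝ → ℝ) (t : ℝ) (α : Fin L → ℝ)

theorem gMat_zero_zero : gMat p w t α 0 0 = eqB p t + (eqA p w t α) ^ 2 := by
  simp [gMat]

theorem gMat_zero_coord {j : Fin L} (hj : j ≠ 0) :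
    gMat p w t α 0 j = -(p j t) * eqA p w t α := by
  simp [gMat, hj]

theorem gMat_coord_zero {i : Fin L} (hi : i ≠ 0) :
    gMat p w t α i 0 = -(p i t) * eqA p w t α := by
  simp [gMat, hi]

theorem gMat_coord_coord {i j : Fin L} (hi : i ≠ 0) (hj : j ≠ 0) :
    gMat p w t α i j = p i t * p j t + (if i = j then 1 else 0) := by
  simp [gMat, hi, hj]

theorem gMat_comm (i j : Fin L) : gMat p w t α i j = gMat p w t α j i := by
  by_cases hi : i = 0 <;> by_cases hj : j = 0
  · rw [hi, hj]
  · rw [hi, gMat_zero_coord p w t α hj, gMat_coord_zero p w t α hj]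
  · rw [hj, gMat_zero_coord p w t α hi, gMat_coord_zero p w t α hi]
  · rw [gMat_coord_coord p w t α hi hj, gMat_coord_coord p w t α hj hi, mul_comm]
    simp only [eq_comm]

theorem vecMul_gMat_zero (x : Fin L → ℝ) :
    (x ᵥ* gMat p w t α) 0 = x 0 * (eqB p t + (eqA p w t α) ^ 2)
      - eqA p w t α * ∑ m ∈ Finset.univ \ {0}, p m t * x m := by
  rw [Matrix.vecMul, dotProduct, sum_univ_eq_zero_add, gMat_zero_zero, sub_eq_add_neg,
    Finset.mul_sum, ← Finset.sum_neg_distrib]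
  congr 1
  refine Finset.sum_congr rfl fun m hm => ?_
  rw [gMat_coord_zero p w t α (by simpa using hm)]
  ring

theorem vecMul_gMat_coord (x : Fin L → ℝ) {h : Fin L} (hh : h ≠ 0) :
    (x ᵥ* gMat p w t α) h = -(p h t * eqA p w t α * x 0)
      + p h t * ∑ m ∈ Finset.univ \ {0}, p m t * x m + x h := by
  have key : ∑ m ∈ Finset.univ \ {0}, x m * gMat p w t α m h
      = ∑ m ∈ Finset.univ \ {0}, (p h t * (p m t * x m) + if m = h then x m else 0) := by
    refine Finset.sum_congr rfl fun m hm => ?_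
    rw [gMat_coord_coord p w t α (by simpa using hm) hh]
    split_ifs <;> ring
  rw [Matrix.vecMul, dotProduct, sum_univ_eq_zero_add, key, gMat_zero_coord p w t α hh,
    Finset.sum_add_distrib, Finset.sum_ite_eq', if_pos (by simp [hh]), Finset.mul_sum]
  ring

theorem eqN_pos : 0 < eqN p t := by
  unfold eqN
  positivity

theorem sum_mul_self_eq : ∑ m ∈ Finset.univ \ {0}, p m t * p m t = eqN p t - 1 := by
  simp [eqN, sq]

variable {p w t α}

theorem eqN_mul_eqB_add_pos (hreg : 0 < eqB p t ∨ deriv w t ≠ 0) :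
    0 < eqN p t * eqB p t + (eqA p w t α) ^ 2 := by
  have hN := eqN_pos p t
  have hB : 0 ≤ eqB p t := Finset.sum_nonneg fun _ _ => sq_nonneg _
  rcases hB.lt_or_eq with hB | hB
  · positivity
  · have hw : deriv w t ≠ 0 := hreg.resolve_left hB.symm.le.not_gt
    have hz : ∀ m ∈ Finset.univ \ {(0 : Fin L)}, deriv (p m) t = 0 := fun m hm => by
      simpa using (Finset.sum_eq_zero_iff_of_nonneg fun _ _ => sq_nonneg _).1 hB.symm m hm
    have hA : eqA p w t α = deriv w t := by
      rw [eqA, Finset.sum_eq_zero fun m hm => by rw [hz m hm, zero_mul], sub_zero]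
    rw [← hB, hA]
    positivity

theorem isUnit_det_gMat (hD : eqN p t * eqB p t + (eqA p w t α) ^ 2 ≠ 0) :
    IsUnit (gMat p w t α).det := by
  rw [← Matrix.isUnit_iff_isUnit_det, ← Matrix.vecMul_injective_iff_isUnit]
  refine (injective_iff_map_eq_zero (gMat p w t α).vecMulLinear).2 fun x hx => ?_
  replace hx : x ᵥ* gMat p w t α = 0 := hx
  have h0 := vecMul_gMat_zero p w t α x
  rw [hx, Pi.zero_apply] at h0
  have hc : ∀ h : Fin L, h ≠ 0 → x h = p h t * (eqA p w t α * x 0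
      - ∑ m ∈ Finset.univ \ {0}, p m t * x m) := fun h hh => by
    have := vecMul_gMat_coord p w t α x hh
    rw [hx, Pi.zero_apply] at this
    linarith
  have hS : ∑ m ∈ Finset.univ \ {0}, p m t * x m = (eqN p t - 1) * (eqA p w t α * x 0
      - ∑ m ∈ Finset.univ \ {0}, p m t * x m) := by
    rw [← sum_mul_self_eq, Finset.sum_mul]
    refine Finset.sum_congr rfl fun m hm => ?_
    rw [hc m (by simpa using hm)]
    ring
  generalize ∑ m ∈ Finset.univ \ {0}, p m t * x m = S at h0 hc hS
  have hx0 : x 0 = 0 := by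
    refine (mul_eq_zero.1 (?_ : (eqN p t * eqB p t + (eqA p w t α) ^ 2) * x 0 = 0)).resolve_left hD
    linear_combination (-eqN p t) * h0 + eqA p w t α * hS
  have hS0 : S = 0 := by
    refine (mul_eq_zero.1 (?_ : eqN p t * S = 0)).resolve_left (eqN_pos p t).ne'
    rw [hx0] at hS
    linear_combination hS
  ext h
  by_cases hh : h = 0
  · rw [hh, hx0, Pi.zero_apply]
  · rw [hc h hh, hx0, hS0, Pi.zero_apply]
    ring

theorem vecMul_christoffel (hD : eqN p t * eqB p t + (eqA p w t α) ^ 2 ≠ 0) (i j h : Fin L) :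
    ∑ k, christoffel p w i j k t α * gMat p w t α k h = lowerChristoffel p w i j h t α := by
  have hΓ : (fun k => christoffel p w i j k t α)
      = (fun h => lowerChristoffel p w i j h t α) ᵥ* (gMat p w t α)⁻¹ := by
    ext k
    rw [christoffel, Matrix.vecMul, dotProduct, Finset.mul_sum]
    refine Finset.sum_congr rfl fun h _ => ?_
    rw [lowerChristoffel]
    ring
  change ((fun k => christoffel p w i j k t α) ᵥ* gMat p w t α) h = _
  rw [hΓ, Matrix.vecMul_vecMul, Matrix.nonsing_inv_mul _ (isUnit_det_gMat hD), Matrix.vecMul_one]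

theorem christoffel_eq_of_vecMul (hD : eqN p t * eqB p t + (eqA p w t α) ^ 2 ≠ 0) {i j : Fin L}
    {x : Fin L → ℝ} (hx : ∀ h, (x ᵥ* gMat p w t α) h = lowerChristoffel p w i j h t α)
    (k : Fin L) : christoffel p w i j k t α = x k := by
  have hinj := Matrix.vecMul_injective_iff_isUnit.2
    ((Matrix.isUnit_iff_isUnit_det _).2 (isUnit_det_gMat hD))
  refine congrFun (hinj (funext fun h => ?_) : (fun k => christoffel p w i j k t α) = x) k
  exact (vecMul_christoffel hD i j h).trans (hx h).symm

end Entries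

section PartialDerivatives

variable [NeZero L] {p : Fin L → ℝ → ℝ} {w : ℝ → ℝ}

theorem hasDerivAt_gMat_zero_zero_time (hp' : ∀ i, Differentiable ℝ (deriv (p i)))
    (hw : Differentiable ℝ (deriv w)) (t : ℝ) (α : Fin L → ℝ) :
    HasDerivAt (fun s => gMat p w s α 0 0)
      (2 * eqC p t + 2 * eqA p w t α * eqA' p w t α) t := by
  simp only [gMat_zero_zero]
  refine ((hasDerivAt_eqB hp' t).add ((hasDerivAt_eqA_time hp' hw t α).pow 2)).congr_deriv ?_
  simp

theorem hasDerivAt_gMat_zero_coord_time (hp : ∀ i, Differentiable ℝ (p i))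
    (hp' : ∀ i, Differentiable ℝ (deriv (p i)))
    (hw : Differentiable ℝ (deriv w)) {j : Fin L} (hj : j ≠ 0) (t : ℝ) (α : Fin L → ℝ) :
    HasDerivAt (fun s => gMat p w s α 0 j)
      (-(deriv (p j) t * eqA p w t α + p j t * eqA' p w t α)) t := by
  simp only [gMat_zero_coord p w _ _ hj]
  refine ((hp j t).hasDerivAt.neg.mul (hasDerivAt_eqA_time hp' hw t α)).congr_deriv ?_
  simp only [Pi.neg_apply]
  ring

theorem hasDerivAt_gMat_coord_coord_time (hp : ∀ i, Differentiable ℝ (p i))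
    {i j : Fin L} (hi : i ≠ 0) (hj : j ≠ 0) (t : ℝ) (α : Fin L → ℝ) :
    HasDerivAt (fun s => gMat p w s α i j) (deriv (p i) t * p j t + p i t * deriv (p j) t) t := by
  simp only [gMat_coord_coord p w _ _ hi hj]
  exact ((hp i t).hasDerivAt.mul (hp j t).hasDerivAt).add_const _

variable (p w)

theorem hasDerivAt_gMat_zero_zero_coord {k : Fin L} (hk : k ≠ 0) (t : ℝ) (α : Fin L → ℝ) :
    HasDerivAt (fun s => gMat p w t (Function.update α k s) 0 0)
      (-(2 * eqA p w t α * deriv (p k) t)) (α k) := by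
  simp only [gMat_zero_zero]
  refine (((hasDerivAt_eqA_coord p w t α hk (α k)).pow 2).const_add _).congr_deriv ?_
  simp

theorem hasDerivAt_gMat_zero_coord_coord {j k : Fin L} (hj : j ≠ 0) (hk : k ≠ 0)
    (t : ℝ) (α : Fin L → ℝ) :
    HasDerivAt (fun s => gMat p w t (Function.update α k s) 0 j)
      (p j t * deriv (p k) t) (α k) := by
  simp only [gMat_zero_coord p w _ _ hj]
  refine ((hasDerivAt_eqA_coord p w t α hk (α k)).const_mul _).congr_deriv ?_
  ring

theorem hasDerivAt_gMat_coord_coord_coord {i j : Fin L} (hi : i ≠ 0) (hj : j ≠ 0)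
    (k : Fin L) (t : ℝ) (α : Fin L → ℝ) :
    HasDerivAt (fun s => gMat p w t (Function.update α k s) i j) 0 (α k) := by
  simp only [gMat_coord_coord p w _ _ hi hj]
  exact hasDerivAt_const _ _

end PartialDerivatives

/-! ### Christoffel symbols -/

section Christoffel

variable [NeZero L] {p : Fin L → ℝ → ℝ} {w : ℝ → ℝ}

theorem pder_zero (f : ℝ → (Fin L → ℝ) → ℝ) (t : ℝ) (α : Fin L → ℝ) :
    pder 0 f t α = deriv (fun s => f s α) t := if_pos rfl

theorem pder_coord {k : Fin L} (hk : k ≠ 0) (f : ℝ → (Fin L → ℝ) → ℝ) (t : ℝ) (α : Fin L → ℝ) :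
    pder k f t α = deriv (fun s => f t (Function.update α k s)) (α k) := if_neg hk

theorem lowerChristoffel_zero_zero_zero (hp' : ∀ i, Differentiable ℝ (deriv (p i)))
    (hw : Differentiable ℝ (deriv w)) (t : ℝ) (α : Fin L → ℝ) :
    lowerChristoffel p w 0 0 0 t α = eqC p t + eqA p w t α * eqA' p w t α := by
  rw [lowerChristoffel, pder_zero, (hasDerivAt_gMat_zero_zero_time hp' hw t α).deriv]
  ring

theorem lowerChristoffel_zero_zero_coord (hp : ∀ i, Differentiable ℝ (p i))
    (hp' : ∀ i, Differentiable ℝ (deriv (p i)))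
    (hw : Differentiable ℝ (deriv w)) {h : Fin L} (hh : h ≠ 0) (t : ℝ) (α : Fin L → ℝ) :
    lowerChristoffel p w 0 0 h t α = -(p h t * eqA' p w t α) := by
  simp only [lowerChristoffel, gMat_comm p w _ _ h 0, pder_zero, pder_coord hh]
  rw [(hasDerivAt_gMat_zero_coord_time hp hp' hw hh t α).deriv,
    (hasDerivAt_gMat_zero_zero_coord p w hh t α).deriv]
  ring

theorem lowerChristoffel_coord_zero_zero {i : Fin L} (hi : i ≠ 0) (t : ℝ) (α : Fin L → ℝ) :
    lowerChristoffel p w i 0 0 t α = -(deriv (p i) t * eqA p w t α) := by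
  simp only [lowerChristoffel, gMat_comm p w _ _ i 0, pder_zero, pder_coord hi]
  rw [(hasDerivAt_gMat_zero_zero_coord p w hi t α).deriv]
  ring

theorem lowerChristoffel_coord_zero_coord (hp : ∀ i, Differentiable ℝ (p i))
    {i h : Fin L} (hi : i ≠ 0) (hh : h ≠ 0) (t : ℝ) (α : Fin L → ℝ) :
    lowerChristoffel p w i 0 h t α = deriv (p i) t * p h t := by
  simp only [lowerChristoffel, gMat_comm p w _ _ i 0, pder_zero, pder_coord hi, pder_coord hh]
  rw [(hasDerivAt_gMat_zero_coord_coord p w hh hi t α).deriv,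
    (hasDerivAt_gMat_coord_coord_time hp hh hi t α).deriv,
    (hasDerivAt_gMat_zero_coord_coord p w hi hh t α).deriv]
  ring

theorem lowerChristoffel_comm (i j h : Fin L) (t : ℝ) (α : Fin L → ℝ) :
    lowerChristoffel p w i j h t α = lowerChristoffel p w j i h t α := by
  simp only [lowerChristoffel, gMat_comm p w _ _ h, gMat_comm p w _ _ j i]
  ring

theorem lowerChristoffel_coord_coord_coord {i j h : Fin L} (hi : i ≠ 0) (hj : j ≠ 0)
    (hh : h ≠ 0) (t : ℝ) (α : Fin L → ℝ) : lowerChristoffel p w i j h t α = 0 := by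
  simp only [lowerChristoffel, pder_coord hi, pder_coord hj, pder_coord hh]
  rw [(hasDerivAt_gMat_coord_coord_coord p w hj hh i t α).deriv,
    (hasDerivAt_gMat_coord_coord_coord p w hh hi j t α).deriv,
    (hasDerivAt_gMat_coord_coord_coord p w hi hj h t α).deriv]
  ring

theorem christoffel_zero_zero (hp : ∀ i, Differentiable ℝ (p i))
    (hp' : ∀ i, Differentiable ℝ (deriv (p i)))
    (hw : Differentiable ℝ (deriv w)) {t : ℝ} {α : Fin L → ℝ}
    (hD : eqN p t * eqB p t + (eqA p w t α) ^ 2 ≠ 0) (k : Fin L) :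
    christoffel p w 0 0 k t α =
      (if k = 0 then eqN p t * eqC p t + eqA p w t α * eqA' p w t α
        else p k t * (eqA p w t α * eqC p t - eqA' p w t α * eqB p t))
        / (eqN p t * eqB p t + (eqA p w t α) ^ 2) := by
  refine christoffel_eq_of_vecMul hD (x := fun k => (if k = 0 then
    eqN p t * eqC p t + eqA p w t α * eqA' p w t α
    else p k t * (eqA p w t α * eqC p t - eqA' p w t α * eqB p t))
      / (eqN p t * eqB p t + (eqA p w t α) ^ 2)) (fun h => ?_) k
  have hS : ∑ m ∈ Finset.univ \ {0}, p m t * ((if m = 0 then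
      eqN p t * eqC p t + eqA p w t α * eqA' p w t α
      else p m t * (eqA p w t α * eqC p t - eqA' p w t α * eqB p t))
        / (eqN p t * eqB p t + (eqA p w t α) ^ 2))
      = (eqN p t - 1) * ((eqA p w t α * eqC p t - eqA' p w t α * eqB p t)
        / (eqN p t * eqB p t + (eqA p w t α) ^ 2)) := by
    rw [← sum_mul_self_eq, Finset.sum_mul]
    refine Finset.sum_congr rfl fun m hm => ?_
    rw [if_neg (by simpa using hm)]
    ring
  by_cases hh : h = 0
  · subst hh
    rw [vecMul_gMat_zero, hS, lowerChristoffel_zero_zero_zero hp' hw, if_pos rfl]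
    field_simp
    ring
  · rw [vecMul_gMat_coord p w t α _ hh, hS, lowerChristoffel_zero_zero_coord hp hp' hw hh,
      if_pos rfl, if_neg hh]
    field_simp
    ring

theorem christoffel_coord_zero (hp : ∀ i, Differentiable ℝ (p i)) {t : ℝ} {α : Fin L → ℝ}
    (hD : eqN p t * eqB p t + (eqA p w t α) ^ 2 ≠ 0) {i : Fin L} (hi : i ≠ 0) (k : Fin L) :
    christoffel p w i 0 k t α =
      deriv (p i) t * (if k = 0 then -eqA p w t α else p k t * eqB p t)
        / (eqN p t * eqB p t + (eqA p w t α) ^ 2) := by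
  refine christoffel_eq_of_vecMul hD (x := fun k =>
    deriv (p i) t * (if k = 0 then -eqA p w t α else p k t * eqB p t)
      / (eqN p t * eqB p t + (eqA p w t α) ^ 2)) (fun h => ?_) k
  have hS : ∑ m ∈ Finset.univ \ {0}, p m t * (deriv (p i) t *
      (if m = 0 then -eqA p w t α else p m t * eqB p t)
        / (eqN p t * eqB p t + (eqA p w t α) ^ 2))
      = (eqN p t - 1) * (deriv (p i) t * eqB p t
        / (eqN p t * eqB p t + (eqA p w t α) ^ 2)) := by
    rw [← sum_mul_self_eq, Finset.sum_mul]
    refine Finset.sum_congr rfl fun m hm => ?_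
    rw [if_neg (by simpa using hm)]
    ring
  by_cases hh : h = 0
  · subst hh
    rw [vecMul_gMat_zero, hS, lowerChristoffel_coord_zero_zero hi, if_pos rfl]
    field_simp
    ring
  · rw [vecMul_gMat_coord p w t α _ hh, hS, lowerChristoffel_coord_zero_coord hp hi hh,
      if_pos rfl, if_neg hh]
    field_simp
    ring

end Christoffel

/-! ### The curvature contraction -/

theorem sum_deriv_mul_eq {ι : Type*} [Fintype ι] {f g : ι → ℝ → ℝ} {g' : ι → ℝ} {h : ℝ → ℝ}
    {h' x : ℝ} (hf : ∀ s, DifferentiableAt ℝ (f s) x) (hg : ∀ s, HasDerivAt (g s) (g' s) x)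
    (hfg : ∀ y, ∑ s, f s y * g s y = h y) (hh : HasDerivAt h h' x) :
    ∑ s, deriv (f s) x * g s x = h' - ∑ s, f s x * g' s := by
  have hsum := HasDerivAt.fun_sum (u := Finset.univ) fun s _ => (hf s).hasDerivAt.mul (hg s)
  have := hsum.unique (hh.congr_of_eventuallyEq (Filter.Eventually.of_forall hfg))
  rw [← this, Finset.sum_add_distrib]
  ring

section Curvature

variable [NeZero L] {p : Fin L → ℝ → ℝ} {w : ℝ → ℝ}

theorem sum_pder_coord_christoffel_zero_zero (hp : ∀ i, Differentiable ℝ (p i))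
    (hp' : ∀ i, Differentiable ℝ (deriv (p i))) (hw : Differentiable ℝ (deriv w))
    (hD : ∀ t α, eqN p t * eqB p t + (eqA p w t α) ^ 2 ≠ 0) {i : Fin L} (hi : i ≠ 0)
    (t : ℝ) (α : Fin L → ℝ) :
    ∑ s, pder i (christoffel p w 0 0 s) t α * gMat p w t α s i
      = p i t * deriv (deriv (p i)) t
        - christoffel p w 0 0 0 t α * (p i t * deriv (p i) t) := by
  have hA := (hasDerivAt_eqA_coord p w t α hi (α i)).differentiableAt
  have hA' := (hasDerivAt_eqA'_coord p w t α hi (α i)).differentiableAt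
  have hf : ∀ s, DifferentiableAt ℝ
      (fun y => christoffel p w 0 0 s t (Function.update α i y)) (α i) := by
    intro s
    simp only [christoffel_zero_zero hp hp' hw (hD _ _)]
    refine DifferentiableAt.fun_div ?_ (by fun_prop) (hD _ _)
    split_ifs <;> fun_prop
  have hg : ∀ s, HasDerivAt (fun y => gMat p w t (Function.update α i y) s i)
      (if s = 0 then p i t * deriv (p i) t else 0) (α i) := by
    intro s
    split_ifs with hs
    · rw [hs]
      exact hasDerivAt_gMat_zero_coord_coord p w hi hi t α
    · exact hasDerivAt_gMat_coord_coord_coord p w hs hi i t α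
  have hh : HasDerivAt (fun y => -(p i t * eqA' p w t (Function.update α i y)))
      (p i t * deriv (deriv (p i)) t) (α i) :=
    ((hasDerivAt_eqA'_coord p w t α hi (α i)).const_mul (p i t)).neg.congr_deriv (by ring)
  have := sum_deriv_mul_eq hf hg (fun y => by
    rw [vecMul_christoffel (hD _ _), lowerChristoffel_zero_zero_coord hp hp' hw hi]) hh
  simpa [pder_coord hi] using this

theorem sum_pder_zero_christoffel_coord_zero (hp : ∀ i, Differentiable ℝ (p i))
    (hp' : ∀ i, Differentiable ℝ (deriv (p i))) (hw : Differentiable ℝ (deriv w))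
    (hD : ∀ t α, eqN p t * eqB p t + (eqA p w t α) ^ 2 ≠ 0) {i : Fin L} (hi : i ≠ 0)
    (t : ℝ) (α : Fin L → ℝ) :
    ∑ s, pder 0 (christoffel p w i 0 s) t α * gMat p w t α s i
      = deriv (deriv (p i)) t * p i t + deriv (p i) t ^ 2
        - ∑ s, christoffel p w i 0 s t α *
          (if s = 0 then -(deriv (p i) t * eqA p w t α + p i t * eqA' p w t α)
            else deriv (p s) t * p i t + p s t * deriv (p i) t) := by
  have hA := (hasDerivAt_eqA_time hp' hw t α).differentiableAt
  have hB := (hasDerivAt_eqB hp' t).differentiableAt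
  have hN := differentiable_eqN hp
  have hf : ∀ s, DifferentiableAt ℝ (fun y => christoffel p w i 0 s y α) t := by
    intro s
    simp only [christoffel_coord_zero hp (hD _ _) hi]
    refine DifferentiableAt.fun_div ?_ (by fun_prop) (hD _ _)
    split_ifs <;> fun_prop
  have hg : ∀ s, HasDerivAt (fun y => gMat p w y α s i)
      (if s = 0 then -(deriv (p i) t * eqA p w t α + p i t * eqA' p w t α)
        else deriv (p s) t * p i t + p s t * deriv (p i) t) t := by
    intro s
    split_ifs with hs
    · rw [hs]
      exact hasDerivAt_gMat_zero_coord_time hp hp' hw hi t α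
    · exact hasDerivAt_gMat_coord_coord_time hp hs hi t α
  have hh : HasDerivAt (fun y => deriv (p i) y * p i y)
      (deriv (deriv (p i)) t * p i t + deriv (p i) t ^ 2) t :=
    ((hp' i t).hasDerivAt.mul (hp i t).hasDerivAt).congr_deriv (by ring)
  have := sum_deriv_mul_eq hf hg (fun y => by
    rw [vecMul_christoffel (hD _ _), lowerChristoffel_coord_zero_coord hp hi hi]) hh
  simpa only [pder_zero] using this

theorem sum_christoffel_mul_christoffel_mul_gMat {t : ℝ} {α : Fin L → ℝ}
    (hD : eqN p t * eqB p t + (eqA p w t α) ^ 2 ≠ 0) (a b j h : Fin L) :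
    ∑ s, (∑ m, christoffel p w a b m t α * christoffel p w j m s t α) * gMat p w t α s h
      = ∑ m, christoffel p w a b m t α * lowerChristoffel p w j m h t α := by
  simp only [← vecMul_christoffel hD, Finset.sum_mul, Finset.mul_sum, mul_assoc]
  exact Finset.sum_comm

end Curvature

theorem statement_15 (L : ℕ) [NeZero L] (hL : 2 ≤ L)
    (p : Fin L → ℝ → ℝ) (w : ℝ → ℝ)
    (hp : ∀ i, ContDiff ℝ (⊤ : ℕ∞) (p i)) (hw : ContDiff ℝ (⊤ : ℕ∞) w)
    (hreg : ∀ t : ℝ, 0 < eqB p t ∨ deriv w t ≠ 0) :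
    ∀ i : Fin L, i ≠ 0 →
      ∀ (t : ℝ) (α : Fin L → ℝ),
        ∑ s : Fin L, curvR p w 0 i 0 s t α * gMat p w t α s i
          = -(deriv (p i) t) ^ 2 * eqB p t / (eqN p t * eqB p t + (eqA p w t α) ^ 2) := by
  intro i hi t α
  have hp₁ : ∀ i, Differentiable ℝ (p i) := fun i => (hp i).differentiable (by simp)
  have hp₂ : ∀ i, Differentiable ℝ (deriv (p i)) := fun i =>
    (contDiff_infty_iff_deriv.1 (hp i)).2.differentiable (by simp)
  have hw₂ : Differentiable ℝ (deriv w) :=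
    (contDiff_infty_iff_deriv.1 hw).2.differentiable (by simp)
  have hD : ∀ t α, eqN p t * eqB p t + (eqA p w t α) ^ 2 ≠ 0 := fun t _ =>
    (eqN_mul_eqB_add_pos (hreg t)).ne'
  have hT₁ : ∑ m, christoffel p w 0 0 m t α * lowerChristoffel p w i m i t α
      = christoffel p w 0 0 0 t α * (deriv (p i) t * p i t) := by
    rw [sum_univ_eq_zero_add, lowerChristoffel_coord_zero_coord hp₁ hi hi,
      Finset.sum_eq_zero fun m hm => by
        rw [lowerChristoffel_coord_coord_coord hi (by simpa using hm) hi, mul_zero], add_zero]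
  have hT₂ : ∑ m, christoffel p w i 0 m t α * lowerChristoffel p w 0 m i t α
      - ∑ s, christoffel p w i 0 s t α *
          (if s = 0 then -(deriv (p i) t * eqA p w t α + p i t * eqA' p w t α)
            else deriv (p s) t * p i t + p s t * deriv (p i) t)
      = -(deriv (p i) t ^ 2 * (eqA p w t α ^ 2 + (eqN p t - 1) * eqB p t)
        / (eqN p t * eqB p t + (eqA p w t α) ^ 2)) := by
    have hrest : ∑ m ∈ Finset.univ \ {0}, christoffel p w i 0 m t α *
        (lowerChristoffel p w 0 m i t α -
          (if m = 0 then -(deriv (p i) t * eqA p w t α + p i t * eqA' p w t α)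
            else deriv (p m) t * p i t + p m t * deriv (p i) t))
        = (eqN p t - 1) * (-(deriv (p i) t ^ 2 * eqB p t)
          / (eqN p t * eqB p t + (eqA p w t α) ^ 2)) := by
      rw [← sum_mul_self_eq, Finset.sum_mul]
      refine Finset.sum_congr rfl fun m hm => ?_
      have hm0 : m ≠ 0 := by simpa using hm
      rw [lowerChristoffel_comm, lowerChristoffel_coord_zero_coord hp₁ hm0 hi,
        christoffel_coord_zero hp₁ (hD _ _) hi, if_neg hm0, if_neg hm0]
      ring
    rw [← Finset.sum_sub_distrib]
    simp only [← mul_sub]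
    rw [sum_univ_eq_zero_add, hrest, lowerChristoffel_zero_zero_coord hp₁ hp₂ hw₂ hi,
      christoffel_coord_zero hp₁ (hD _ _) hi, if_pos rfl, if_pos rfl]
    ring
  simp only [curvR, add_mul, sub_mul, Finset.sum_add_distrib, Finset.sum_sub_distrib]
  rw [sum_christoffel_mul_christoffel_mul_gMat (hD _ _),
    sum_christoffel_mul_christoffel_mul_gMat (hD _ _),
    sum_pder_coord_christoffel_zero_zero hp₁ hp₂ hw₂ hD hi,
    sum_pder_zero_christoffel_coord_zero hp₁ hp₂ hw₂ hD hi, hT₁]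
  have hfrac : deriv (p i) t ^ 2 * (eqA p w t α ^ 2 + (eqN p t - 1) * eqB p t)
        / (eqN p t * eqB p t + (eqA p w t α) ^ 2) - deriv (p i) t ^ 2
      = -(deriv (p i) t) ^ 2 * eqB p t / (eqN p t * eqB p t + (eqA p w t α) ^ 2) := by
    have := hD t α
    field_simp
    ring
  linear_combination hfrac - hT₂

end EqSelection
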